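/- There exists a constant C depending only on Λ with the following property. Let R > 0, let B_{3R} ⊂ ℝ³ be the open ball of radius 3R centered at a point p, and let u be a positive C² function on B_{3R} satisfying Δu + K(x)u⁵ = 0 in B_{3R}, where K is C¹ on B_{3R} with Λ⁻¹ ≤ K(x) ≤ Λ and |∇K(x)| ≤ Λ R⁻¹. Then (sup over B_R of u) · (inf over B_{2R} of u) ≤ C R⁻¹, where B_R and B_{2R} are the concentric balls of radii R and 2R. -/

import Mathlib

open Metric Set MeasureTheory

noncomputable section

abbrev E3 := EuclideanSpace ℝ (Fin 3)

/-- The Euclidean Laplacian on ℝ³. -/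
noncomputable def lap (u : E3 → ℝ) (x : E3) : ℝ :=
  ∑ i : Fin 3, fderiv ℝ (fun y => fderiv ℝ u y (EuclideanSpace.single i 1)) x
    (EuclideanSpace.single i 1)

/-- The third standard basis vector of ℝ³. -/
noncomputable def e3 : E3 := EuclideanSpace.single 2 1

lemma lap_eq_sum_orthonormalBasis {v : E3 → ℝ} {x : E3} (hv : ContDiffAt ℝ 2 v x)
    (f : OrthonormalBasis (Fin 3) ℝ E3) :
    lap v x = ∑ i, fderiv ℝ (fderiv ℝ v) x (f i) (f i) := by
  have hd : DifferentiableAt ℝ (fderiv ℝ v) x :=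
    (hv.fderiv_right (m := 1) (by norm_num)).differentiableAt (by norm_num)
  have h1 := congrFun (InnerProductSpace.laplacian_eq_iteratedFDeriv_orthonormalBasis v f) x
  have h2 := congrFun (InnerProductSpace.laplacian_eq_iteratedFDeriv_orthonormalBasis v
    (EuclideanSpace.basisFun (Fin 3) ℝ)) x
  rw [h1] at h2
  simp only [iteratedFDeriv_two_apply] at h2
  simp only [lap]
  simp at h2
  rw [h2]
  refine Finset.sum_congr rfl fun i _ => ?_
  rw [fderiv_clm_apply hd (by fun_prop)]
  simp

/-- `g` is twice differentiable at `0` with second derivative `c`. -/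
def HasSecondDerivAtZero (g : ℝ → ℝ) (c : ℝ) : Prop :=
  ∃ g' : ℝ → ℝ, (∀ᶠ s in nhds 0, HasDerivAt g (g' s) s) ∧ HasDerivAt g' c 0

namespace HasSecondDerivAtZero
variable {g k : ℝ → ℝ} {c d : ℝ}

lemma add (hg : HasSecondDerivAtZero g c) (hk : HasSecondDerivAtZero k d) :
    HasSecondDerivAtZero (fun s => g s + k s) (c + d) := by
  obtain ⟨g', h1, h2⟩ := hg
  obtain ⟨k', h3, h4⟩ := hk
  exact ⟨fun s => g' s + k' s, by filter_upwards [h1, h3] with s a b using a.add b, h2.add h4⟩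

lemma sub (hg : HasSecondDerivAtZero g c) (hk : HasSecondDerivAtZero k d) :
    HasSecondDerivAtZero (fun s => g s - k s) (c - d) := by
  obtain ⟨g', h1, h2⟩ := hg
  obtain ⟨k', h3, h4⟩ := hk
  exact ⟨fun s => g' s - k' s, by filter_upwards [h1, h3] with s a b using a.sub b, h2.sub h4⟩

lemma const_mul (a : ℝ) (hg : HasSecondDerivAtZero g c) :
    HasSecondDerivAtZero (fun s => a * g s) (a * c) := by
  obtain ⟨g', h1, h2⟩ := hg
  exact ⟨fun s => a * g' s, by filter_upwards [h1] with s h using h.const_mul a, h2.const_mul a⟩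

lemma congr_value (hg : HasSecondDerivAtZero g c) (h : c = d) : HasSecondDerivAtZero g d := h ▸ hg

lemma comp_neg (hg : HasSecondDerivAtZero g c) : HasSecondDerivAtZero (fun s => g (-s)) c := by
  obtain ⟨g', h1, h2⟩ := hg
  have ht : Filter.Tendsto (fun s : ℝ => -s) (nhds 0) (nhds 0) := by
    simpa using (continuous_neg (G := ℝ)).tendsto 0
  refine ⟨fun s => -g' (-s), ?_, ?_⟩
  · filter_upwards [ht.eventually h1] with s h
    have := HasDerivAt.scomp s h (hasDerivAt_neg s)
    rwa [neg_one_smul] at this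
  · have h2' : HasDerivAt g' c (-0) := by simpa using h2
    have := (HasDerivAt.scomp (0 : ℝ) h2' (hasDerivAt_neg 0)).neg
    rwa [neg_one_smul, neg_neg] at this

lemma nonneg_of_isLocalMin (hg : HasSecondDerivAtZero g c) (hm : IsLocalMin g 0) : 0 ≤ c := by
  obtain ⟨g', h1, h2⟩ := hg
  by_contra! hc
  have hder : deriv g =ᶠ[nhds 0] g' := by filter_upwards [h1] with s h using h.deriv
  have h0 : deriv g 0 = 0 := hm.deriv_eq_zero
  have hdd : deriv (deriv g) 0 = c := by rw [hder.deriv_eq]; exact h2.deriv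
  have hmax := isLocalMax_of_deriv_deriv_neg (by rw [hdd]; exact hc) h0
    h1.self_of_nhds.continuousAt
  have hconst : g =ᶠ[nhds 0] fun _ => g 0 := by
    filter_upwards [hm, hmax] with s a b using le_antisymm b a
  have : deriv (deriv g) 0 = 0 := by
    rw [hconst.deriv.deriv_eq]
    simp
  linarith

lemma exp_mul (a b : ℝ) :
    HasSecondDerivAtZero (fun s => Real.exp (a * s + b)) (a ^ 2 * Real.exp b) := by
  have key : ∀ s, HasDerivAt (fun s => Real.exp (a * s + b)) (a * Real.exp (a * s + b)) s := by
    intro s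
    have := (((hasDerivAt_id s).const_mul a).add_const b).exp
    simpa [mul_comm] using this
  refine ⟨_, Filter.Eventually.of_forall key, ?_⟩
  refine ((key 0).const_mul a).congr_deriv ?_
  rw [mul_zero, zero_add]
  ring

lemma of_mul {g' k' : ℝ → ℝ} (hg : ∀ᶠ s in nhds 0, HasDerivAt g (g' s) s)
    (hg' : HasDerivAt g' c 0) (hk : ∀ᶠ s in nhds 0, HasDerivAt k (k' s) s)
    (hk' : HasDerivAt k' d 0) :
    HasSecondDerivAtZero (fun s => g s * k s) (c * k 0 + 2 * (g' 0 * k' 0) + g 0 * d) := by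
  refine ⟨fun s => g' s * k s + g s * k' s, ?_, ?_⟩
  · filter_upwards [hg, hk] with s a b using a.mul b
  · exact ((hg'.mul hk.self_of_nhds).add (hg.self_of_nhds.mul hk')).congr_deriv (by ring)

end HasSecondDerivAtZero

lemma hasDerivAt_comp_curve {v : E3 → ℝ} {γ γ' : ℝ → E3} (hv : ContDiffAt ℝ 2 v (γ 0))
    (h1 : ∀ s, HasDerivAt γ (γ' s) s) :
    ∀ᶠ s in nhds 0, HasDerivAt (fun s => v (γ s)) (fderiv ℝ v (γ s) (γ' s)) s := by
  filter_upwards [(h1 0).continuousAt.eventually (hv.eventually (by simp))] with s hs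
  exact (hs.differentiableAt (by norm_num)).hasFDerivAt.comp_hasDerivAt s (h1 s)

lemma hasDerivAt_fderiv_comp_curve {v : E3 → ℝ} {γ γ' : ℝ → E3} {γ'' : E3}
    (hv : ContDiffAt ℝ 2 v (γ 0)) (h1 : HasDerivAt γ (γ' 0) 0) (h2 : HasDerivAt γ' γ'' 0) :
    HasDerivAt (fun s => fderiv ℝ v (γ s) (γ' s))
      (fderiv ℝ (fderiv ℝ v) (γ 0) (γ' 0) (γ' 0) + fderiv ℝ v (γ 0) γ'') 0 := by
  have hd : DifferentiableAt ℝ (fderiv ℝ v) (γ 0) :=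
    (hv.fderiv_right (m := 1) (by norm_num)).differentiableAt (by norm_num)
  exact (hd.hasFDerivAt.comp_hasDerivAt (0 : ℝ) h1).clm_apply h2

lemma hasSecondDerivAtZero_comp_curve {v : E3 → ℝ} {γ γ' : ℝ → E3} {γ'' : E3}
    (hv : ContDiffAt ℝ 2 v (γ 0)) (h1 : ∀ s, HasDerivAt γ (γ' s) s)
    (h2 : HasDerivAt γ' γ'' 0) :
    HasSecondDerivAtZero (fun s => v (γ s))
      (fderiv ℝ (fderiv ℝ v) (γ 0) (γ' 0) (γ' 0) + fderiv ℝ v (γ 0) γ'') :=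
  ⟨_, hasDerivAt_comp_curve hv h1, hasDerivAt_fderiv_comp_curve hv (h1 0) h2⟩

/-- The function `|x|^{1/2} v` in logarithmic polar coordinates around `X`. -/
def cyl (v : E3 → ℝ) (X : E3) (t : ℝ) (θ : E3) : ℝ :=
  Real.exp (t / 2) * v (X + Real.exp t • θ)

/-- The derivative of `cyl` in the logarithmic radial variable. -/
def cylDeriv (v : E3 → ℝ) (X : E3) (t : ℝ) (θ : E3) : ℝ :=
  Real.exp (t / 2) * (v (X + Real.exp t • θ) / 2 +
    fderiv ℝ v (X + Real.exp t • θ) (Real.exp t • θ))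

lemma hasDerivAt_cyl {v : E3 → ℝ} {X θ : E3} {t : ℝ}
    (hv : DifferentiableAt ℝ v (X + Real.exp t • θ)) :
    HasDerivAt (fun t => cyl v X t θ) (cylDeriv v X t θ) t := by
  have h1 : HasDerivAt (fun t : ℝ => X + Real.exp t • θ) (Real.exp t • θ) t :=
    ((Real.hasDerivAt_exp t).smul_const θ).const_add X
  have h2 := (((hasDerivAt_id t).div_const 2).exp).mul (hv.hasFDerivAt.comp_hasDerivAt t h1)
  refine h2.congr_deriv ?_
  simp [cylDeriv]
  ring

lemma exists_secondDeriv_cyl {v : E3 → ℝ} {X : E3} {t : ℝ} (f : OrthonormalBasis (Fin 3) ℝ E3)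
    (hv : ContDiffAt ℝ 2 v (X + Real.exp t • f 0)) :
    ∃ a b c : ℝ, HasSecondDerivAtZero (fun s => cyl v X (t + s) (f 0)) a ∧
      HasSecondDerivAtZero
        (fun s => cyl v X t (Real.cos s • f 0 + Real.sin s • f 1)) b ∧
      HasSecondDerivAtZero
        (fun s => cyl v X t (Real.cos s • f 0 + Real.sin s • f 2)) c ∧
      a + b + c = cyl v X t (f 0) / 4 +
        Real.exp (5 * t / 2) * lap v (X + Real.exp t • f 0) := by
  set y := X + Real.exp t • f 0 with hy
  have hang : ∀ e : E3, HasSecondDerivAtZero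
      (fun s => cyl v X t (Real.cos s • f 0 + Real.sin s • e))
      (Real.exp (t / 2) * (Real.exp t ^ 2 * fderiv ℝ (fderiv ℝ v) y e e
        - Real.exp t * fderiv ℝ v y (f 0))) := by
    intro e
    have h1 : ∀ s, HasDerivAt
        (fun s : ℝ => X + Real.exp t • (Real.cos s • f 0 + Real.sin s • e))
        (Real.exp t • ((-Real.sin s) • f 0 + Real.cos s • e)) s := fun s =>
      ((((Real.hasDerivAt_cos s).smul_const (f 0)).add
        ((Real.hasDerivAt_sin s).smul_const e)).const_smul (Real.exp t)).const_add X
    have h2 : HasDerivAt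
        (fun s : ℝ => Real.exp t • ((-Real.sin s) • f 0 + Real.cos s • e))
        (Real.exp t • ((-Real.cos 0) • f 0 + (-Real.sin 0) • e)) 0 :=
      (((Real.hasDerivAt_sin 0).neg.smul_const (f 0)).add
        ((Real.hasDerivAt_cos 0).smul_const e)).const_smul (Real.exp t)
    have h3 := (hasSecondDerivAtZero_comp_curve (v := v) (by simpa [hy] using hv) h1 h2).const_mul
      (Real.exp (t / 2))
    simp only [Real.cos_zero, Real.sin_zero, neg_zero, zero_smul, one_smul, add_zero, zero_add,
      smul_neg, neg_smul, map_neg, map_smul, ← hy, smul_eq_mul,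
      smul_apply] at h3
    unfold cyl
    refine h3.congr_value ?_
    ring
  have hrad : HasSecondDerivAtZero (fun s => cyl v X (t + s) (f 0))
      (Real.exp (t / 2) * (v y / 4 + 2 * Real.exp t * fderiv ℝ v y (f 0) +
        Real.exp t ^ 2 * fderiv ℝ (fderiv ℝ v) y (f 0) (f 0))) := by
    have h1 : ∀ s, HasDerivAt (fun s : ℝ => X + Real.exp (t + s) • f 0)
        (Real.exp (t + s) • f 0) s := fun s => by
      have := (((hasDerivAt_id s).const_add t).exp.smul_const (f 0)).const_add X
      simpa using this
    have h2 : ∀ s, HasDerivAt (fun s : ℝ => Real.exp (t + s) • f 0)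
        (Real.exp (t + s) • f 0) s := fun s => (hasDerivAt_const_add_iff X).1 (h1 s)
    have hv0 : ContDiffAt ℝ 2 v (X + Real.exp (t + 0) • f 0) := by simpa [hy] using hv
    have h3 : ∀ s, HasDerivAt (fun s : ℝ => Real.exp ((t + s) / 2))
        (Real.exp ((t + s) / 2) * (1 / 2)) s := fun s =>
      (((hasDerivAt_id s).const_add t).div_const 2).exp
    have h4 := HasSecondDerivAtZero.of_mul (Filter.Eventually.of_forall h3)
      ((h3 0).mul_const (1 / 2)) (hasDerivAt_comp_curve hv0 h1)
      (hasDerivAt_fderiv_comp_curve hv0 (h1 0) (h2 0))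
    refine h4.congr_value ?_
    simp only [add_zero, ← hy, map_smul, smul_eq_mul, smul_apply]
    ring
  refine ⟨_, _, _, hrad, hang _, hang _, ?_⟩
  rw [lap_eq_sum_orthonormalBasis hv f, Fin.sum_univ_three]
  have : Real.exp (5 * t / 2) = Real.exp (t / 2) * Real.exp t ^ 2 := by
    rw [← Real.exp_nat_mul, ← Real.exp_add]; congr 1; push_cast; ring
  rw [this]
  simp only [cyl, ← hy]
  ring

lemma continuousAt_cyl {v : E3 → ℝ} {X : E3} {p : ℝ × E3}
    (hv : ContinuousAt v (X + Real.exp p.1 • p.2)) :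
    ContinuousAt (fun p : ℝ × E3 => cyl v X p.1 p.2) p := by
  have h1 : ContinuousAt (fun p : ℝ × E3 => X + Real.exp p.1 • p.2) p := by fun_prop
  have h2 : ContinuousAt (fun p : ℝ × E3 => v (X + Real.exp p.1 • p.2)) p :=
    ContinuousAt.comp (f := fun p : ℝ × E3 => X + Real.exp p.1 • p.2) hv h1
  unfold cyl
  fun_prop

lemma continuousAt_cylDeriv {v : E3 → ℝ} {X : E3} {p : ℝ × E3}
    (hv : ContDiffAt ℝ 2 v (X + Real.exp p.1 • p.2)) :
    ContinuousAt (fun p : ℝ × E3 => cylDeriv v X p.1 p.2) p := by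
  have h1 : ContinuousAt (fun p : ℝ × E3 => X + Real.exp p.1 • p.2) p := by fun_prop
  have h2 : ContinuousAt (fun p : ℝ × E3 => v (X + Real.exp p.1 • p.2)) p :=
    ContinuousAt.comp (f := fun p : ℝ × E3 => X + Real.exp p.1 • p.2) hv.continuousAt h1
  have h3 : ContinuousAt (fun p : ℝ × E3 => fderiv ℝ v (X + Real.exp p.1 • p.2)) p :=
    ContinuousAt.comp (f := fun p : ℝ × E3 => X + Real.exp p.1 • p.2)
      (hv.fderiv_right (m := 1) (by norm_num)).continuousAt h1
  unfold cylDeriv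
  fun_prop

/-- The correction compensating the oscillation of the curvature function. -/
def corr (τ t : ℝ) : ℝ :=
  Real.exp (1 / 2 * t + 3 * τ) - 2 * Real.exp (-1 / 2 * t + 4 * τ) +
    Real.exp (-3 / 2 * t + 5 * τ)

lemma corr_eq (τ t : ℝ) :
    corr τ t = Real.exp (t / 2) * (Real.exp (3 * τ) * (1 - Real.exp (τ - t)) ^ 2) := by
  have h1 : Real.exp (1 / 2 * t + 3 * τ) = Real.exp (t / 2) * Real.exp (3 * τ) := by
    rw [← Real.exp_add]; ring_nf
  have h2 : Real.exp (-1 / 2 * t + 4 * τ) =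
      Real.exp (t / 2) * Real.exp (3 * τ) * Real.exp (τ - t) := by
    simp only [← Real.exp_add]; ring_nf
  have h3 : Real.exp (-3 / 2 * t + 5 * τ) =
      Real.exp (t / 2) * Real.exp (3 * τ) * Real.exp (τ - t) * Real.exp (τ - t) := by
    simp only [← Real.exp_add]; ring_nf
  rw [corr, h1, h2, h3]; ring

lemma corr_nonneg (τ t : ℝ) : 0 ≤ corr τ t := by rw [corr_eq]; positivity

lemma corr_le {τ t : ℝ} (h : τ ≤ t) :
    corr τ t ≤ Real.exp (t / 2) * (Real.exp (3 * τ) * (1 - Real.exp (τ - t))) := by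
  rw [corr_eq]
  have h1 : Real.exp (τ - t) ≤ 1 := Real.exp_le_one_iff.2 (by linarith)
  have h2 := Real.exp_pos (τ - t)
  gcongr
  nlinarith

lemma corr_self (τ : ℝ) : corr τ τ = 0 := by simp [corr_eq]

/-- A radial solution of the linearised homogeneous equation vanishing on the sphere. -/
def barrier (τ t : ℝ) : ℝ := Real.exp (1 / 2 * t + -τ) - Real.exp (-1 / 2 * t + 0)

lemma barrier_pos {τ t : ℝ} (h : τ < t) : 0 < barrier τ t :=
  sub_pos.2 (Real.exp_lt_exp.2 (by linarith))

lemma barrier_self (τ : ℝ) : barrier τ τ = 0 := by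
  rw [barrier, sub_eq_zero]; congr 1; ring

lemma hasDerivAt_exp_mul_add (a b t : ℝ) :
    HasDerivAt (fun t => Real.exp (a * t + b)) (a * Real.exp (a * t + b)) t := by
  have := (((hasDerivAt_id t).const_mul a).add_const b).exp
  simpa [mul_comm] using this

lemma HasSecondDerivAtZero.exp_mul_add (a b t : ℝ) :
    HasSecondDerivAtZero (fun s => Real.exp (a * (t + s) + b)) (a ^ 2 * Real.exp (a * t + b)) := by
  convert HasSecondDerivAtZero.exp_mul a (a * t + b) using 3
  ring

lemma hasSecondDerivAtZero_corr (τ t : ℝ) :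
    HasSecondDerivAtZero (fun s => corr τ (t + s))
      (corr τ t / 4 + 2 * Real.exp (-3 / 2 * t + 5 * τ)) :=
  (((HasSecondDerivAtZero.exp_mul_add _ _ t).sub
    ((HasSecondDerivAtZero.exp_mul_add _ _ t).const_mul 2)).add
      (HasSecondDerivAtZero.exp_mul_add _ _ t)).congr_value (by rw [corr]; ring)

lemma hasSecondDerivAtZero_barrier (τ t : ℝ) :
    HasSecondDerivAtZero (fun s => barrier τ (t + s)) (barrier τ t / 4) :=
  ((HasSecondDerivAtZero.exp_mul_add _ _ t).sub
    (HasSecondDerivAtZero.exp_mul_add _ _ t)).congr_value (by rw [barrier]; ring)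

/-- The derivative of `corr` in its second variable. -/
def corrDeriv (τ t : ℝ) : ℝ :=
  1 / 2 * Real.exp (1 / 2 * t + 3 * τ) - 2 * (-1 / 2 * Real.exp (-1 / 2 * t + 4 * τ)) +
    -3 / 2 * Real.exp (-3 / 2 * t + 5 * τ)

lemma hasDerivAt_corr (τ t : ℝ) : HasDerivAt (corr τ) (corrDeriv τ t) t :=
  ((hasDerivAt_exp_mul_add _ _ t).sub ((hasDerivAt_exp_mul_add _ _ t).const_mul 2)).add
    (hasDerivAt_exp_mul_add _ _ t)

lemma hasDerivAt_barrier_self (τ : ℝ) : HasDerivAt (barrier τ) (Real.exp (-(1 / 2) * τ)) τ := by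
  refine ((hasDerivAt_exp_mul_add (1 / 2) (-τ) τ).sub
    (hasDerivAt_exp_mul_add (-1 / 2) 0 τ)).congr_deriv ?_
  have h1 : 1 / 2 * τ + -τ = -(1 / 2) * τ := by ring
  have h2 : -1 / 2 * τ + 0 = -(1 / 2) * τ := by ring
  rw [h1, h2]; ring

/-- The corrected difference of `v` and its Kelvin transform with respect to the sphere of radius
`exp τ` around `X`, in logarithmic polar coordinates. -/
def reflDiff (v : E3 → ℝ) (X : E3) (A τ t : ℝ) (θ : E3) : ℝ :=
  cyl v X t θ - cyl v X (2 * τ - t) θ - A * corr τ t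

/-- The data of the moving sphere argument around `X`, for spheres of radius at most `exp τ₀`
inside the ball of radius `exp T`. -/
structure MovingSphereSetup (v K : E3 → ℝ) (X : E3) (ρ L B m τ₀ T : ℝ) : Prop where
  exp_lt : Real.exp T < ρ
  lt : τ₀ < T
  contDiffOn : ContDiffOn ℝ 2 v (ball X ρ)
  pos : ∀ x ∈ ball X ρ, 0 < v x
  K_nonneg : ∀ x ∈ ball X ρ, 0 ≤ K x
  lipschitz : ∀ x ∈ ball X ρ, ∀ y ∈ ball X ρ, K y - K x ≤ L * ‖y - x‖
  eq : ∀ x ∈ ball X ρ, lap v x + K x * v x ^ 5 = 0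
  L_pos : 0 < L
  B_pos : 0 < B
  le_B : ∀ x ∈ closedBall X (Real.exp τ₀), v x ≤ B
  m_le : ∀ x ∈ sphere X (Real.exp T), m ≤ v x
  gap : B * Real.exp (τ₀ - T) + L * B ^ 5 * Real.exp (3 * τ₀) < m

namespace MovingSphereSetup

variable {v K : E3 → ℝ} {X : E3} {ρ L B m τ₀ T : ℝ}

lemma mem_ball (h : MovingSphereSetup v K X ρ L B m τ₀ T) {t : ℝ} (ht : t ≤ T) {θ : E3}
    (hθ : ‖θ‖ = 1) : X + Real.exp t • θ ∈ ball X ρ := by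
  have := Real.exp_le_exp.2 ht
  simp [norm_smul, hθ]
  linarith [h.exp_lt]

lemma contDiffAt (h : MovingSphereSetup v K X ρ L B m τ₀ T) {t : ℝ} (ht : t ≤ T) {θ : E3}
    (hθ : ‖θ‖ = 1) : ContDiffAt ℝ 2 v (X + Real.exp t • θ) :=
  h.contDiffOn.contDiffAt (isOpen_ball.mem_nhds (h.mem_ball ht hθ))

lemma continuousAt_reflDiff (h : MovingSphereSetup v K X ρ L B m τ₀ T) (A : ℝ)
    {q : ℝ × ℝ × E3} (hτ : q.1 ≤ q.2.1) (ht : q.2.1 ≤ T) (hθ : ‖q.2.2‖ = 1) :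
    ContinuousAt (fun q : ℝ × ℝ × E3 => reflDiff v X A q.1 q.2.1 q.2.2) q := by
  have h1 : ContinuousAt (fun q : ℝ × ℝ × E3 => cyl v X q.2.1 q.2.2) q :=
    ContinuousAt.comp (g := fun p : ℝ × E3 => cyl v X p.1 p.2) (f := fun q : ℝ × ℝ × E3 => q.2)
      (continuousAt_cyl (h.contDiffAt ht hθ).continuousAt) (by fun_prop)
  have h2 : ContinuousAt (fun q : ℝ × ℝ × E3 => cyl v X (2 * q.1 - q.2.1) q.2.2) q :=
    ContinuousAt.comp (g := fun p : ℝ × E3 => cyl v X p.1 p.2)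
      (f := fun q : ℝ × ℝ × E3 => (2 * q.1 - q.2.1, q.2.2))
      (continuousAt_cyl (h.contDiffAt (by dsimp only; linarith) hθ).continuousAt) (by fun_prop)
  have h3 : Continuous (fun q : ℝ × ℝ × E3 => corr q.1 q.2.1) := by unfold corr; fun_prop
  exact (h1.sub h2).sub (h3.continuousAt.const_mul A)

lemma cyl_le (h : MovingSphereSetup v K X ρ L B m τ₀ T) {t : ℝ} (ht : t ≤ τ₀) {θ : E3}
    (hθ : ‖θ‖ = 1) : cyl v X t θ ≤ Real.exp (t / 2) * B := by
  unfold cyl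
  gcongr
  refine h.le_B _ ?_
  simpa [norm_smul, hθ] using ht

lemma cyl_pos (h : MovingSphereSetup v K X ρ L B m τ₀ T) {t : ℝ} (ht : t ≤ T) {θ : E3}
    (hθ : ‖θ‖ = 1) : 0 < cyl v X t θ :=
  mul_pos (Real.exp_pos _) (h.pos _ (h.mem_ball ht hθ))

lemma reflDiff_outer (h : MovingSphereSetup v K X ρ L B m τ₀ T) {τ : ℝ} (hτ : τ ≤ τ₀) {θ : E3}
    (hθ : ‖θ‖ = 1) :
    Real.exp (T / 2) * (m - (B * Real.exp (τ₀ - T) + L * B ^ 5 * Real.exp (3 * τ₀))) ≤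
      reflDiff v X (L * B ^ 5) τ T θ := by
  have hT := h.lt
  have hL := h.L_pos
  have hB := h.B_pos
  have h1 : Real.exp (T / 2) * m ≤ cyl v X T θ := by
    unfold cyl
    gcongr
    exact h.m_le _ (by simp [norm_smul, hθ])
  have h2 : cyl v X (2 * τ - T) θ ≤ Real.exp (T / 2) * (B * Real.exp (τ₀ - T)) := by
    refine (h.cyl_le (by linarith) hθ).trans ?_
    have : Real.exp ((2 * τ - T) / 2) ≤ Real.exp (T / 2) * Real.exp (τ₀ - T) := by
      rw [← Real.exp_add]; exact Real.exp_le_exp.2 (by linarith)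
    nlinarith
  have h3 : corr τ T ≤ Real.exp (T / 2) * Real.exp (3 * τ₀) := by
    refine (corr_le (by linarith)).trans ?_
    have h4 : Real.exp (3 * τ) ≤ Real.exp (3 * τ₀) := Real.exp_le_exp.2 (by linarith)
    have := Real.exp_pos (τ - T)
    have := Real.exp_pos (3 * τ)
    gcongr
    nlinarith
  have h4 : L * B ^ 5 * corr τ T ≤ L * B ^ 5 * (Real.exp (T / 2) * Real.exp (3 * τ₀)) := by gcongr
  unfold reflDiff
  linarith

lemma reflDiff_self (A τ : ℝ) (θ : E3) : reflDiff v X A τ τ θ = 0 := by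
  have : 2 * τ - τ = τ := by ring
  rw [reflDiff, this, corr_self]; ring

lemma barrier_le_reflDiff (h : MovingSphereSetup v K X ρ L B m τ₀ T) {τ δ : ℝ} (hτ : τ ≤ τ₀)
    (hδT : ∀ θ, ‖θ‖ = 1 → δ * barrier τ T ≤ reflDiff v X (L * B ^ 5) τ T θ)
    (h0 : ∀ t ∈ Icc τ T, ∀ θ, ‖θ‖ = 1 → 0 ≤ reflDiff v X (L * B ^ 5) τ t θ) :
    ∀ t ∈ Icc τ T, ∀ θ, ‖θ‖ = 1 → δ * barrier τ t ≤ reflDiff v X (L * B ^ 5) τ t θ := by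
  set A := L * B ^ 5 with hA
  have hL := h.L_pos
  have hB := h.B_pos
  have hlt := h.lt
  have hA0 : 0 < A := by positivity
  have hcomp : IsCompact (Icc τ T ×ˢ sphere (0 : E3) 1) := isCompact_Icc.prod (isCompact_sphere _ _)
  intro t₁ ht₁ θ₁ hθ₁
  obtain ⟨⟨t, θ⟩, ⟨ht, hθ⟩, hmin⟩ := hcomp.exists_isMinOn ⟨(t₁, θ₁), ht₁, by simpa using hθ₁⟩
    (f := fun p : ℝ × E3 => reflDiff v X A τ p.1 p.2 - δ * barrier τ p.1) (by
      rintro p ⟨hp1, hp2⟩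
      have h1 : ContinuousAt (fun p : ℝ × E3 => reflDiff v X A τ p.1 p.2) p :=
        ContinuousAt.comp (g := fun q : ℝ × ℝ × E3 => reflDiff v X A q.1 q.2.1 q.2.2)
          (f := fun p : ℝ × E3 => (τ, p))
          (h.continuousAt_reflDiff A hp1.1 hp1.2 (by simpa using hp2)) (by fun_prop)
      have h3 : Continuous (fun p : ℝ × E3 => barrier τ p.1) := by unfold barrier; fun_prop
      exact (h1.sub (h3.continuousAt.const_mul δ)).continuousWithinAt)
  simp only [isMinOn_iff, mem_prod, mem_sphere_zero_iff_norm, Prod.forall] at hmin hθ ht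
  have hmin' : ∀ s ∈ Icc τ T, ∀ η : E3, ‖η‖ = 1 →
      reflDiff v X A τ t θ - δ * barrier τ t ≤ reflDiff v X A τ s η - δ * barrier τ s :=
    fun s hs η hη => hmin s η ⟨hs, hη⟩
  suffices H : 0 ≤ reflDiff v X A τ t θ - δ * barrier τ t by
    linarith [hmin' t₁ ht₁ θ₁ hθ₁]
  by_contra! hneg
  have htτ : τ < t := by
    refine lt_of_le_of_ne ht.1 ?_
    rintro rfl
    rw [barrier_self, reflDiff_self] at hneg
    simp at hneg
  have htT : t < T := by
    refine lt_of_le_of_ne ht.2 ?_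
    rintro rfl
    linarith [hδT θ hθ]
  obtain ⟨f, hf⟩ := Orthonormal.exists_orthonormalBasis_extension_of_card_eq (𝕜 := ℝ) (E := E3)
    (ι := Fin 3) (by simp) (v := fun _ => θ) (s := {0}) (by
      rw [orthonormal_iff_ite]
      rintro ⟨i, hi⟩ ⟨j, hj⟩
      simp only [mem_singleton_iff] at hi hj
      subst hi hj
      simp [hθ])
  have hf0 : f 0 = θ := hf 0 rfl
  rw [← hf0] at hneg hmin' hθ
  clear hf0 hf hmin
  have hnorm : ∀ i, i ≠ 0 → ∀ s : ℝ, ‖Real.cos s • f 0 + Real.sin s • f i‖ = 1 := by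
    intro i hi s
    have h1 : inner ℝ (f 0) (f i) = 0 := f.orthonormal.2 hi.symm
    have h2 : ‖Real.cos s • f 0 + Real.sin s • f i‖ ^ 2 = 1 := by
      rw [norm_add_sq_real, inner_smul_left, inner_smul_right, h1]
      simp [norm_smul]
    nlinarith [norm_nonneg (Real.cos s • f 0 + Real.sin s • f i)]
  obtain ⟨a, b, c, ha, hb, hc, habc⟩ := exists_secondDeriv_cyl f (h.contDiffAt ht.2 hθ)
  have ht' : 2 * τ - t ≤ τ₀ := by linarith
  obtain ⟨a', b', c', ha', hb', hc', habc'⟩ :=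
    exists_secondDeriv_cyl f (h.contDiffAt (t := 2 * τ - t) (by linarith) hθ)
  have hrad := (((ha.sub ha'.comp_neg).sub ((hasSecondDerivAtZero_corr τ t).const_mul A)).sub
    ((hasSecondDerivAtZero_barrier τ t).const_mul δ)).nonneg_of_isLocalMin (by
      have : ∀ᶠ s in nhds (0 : ℝ), t + s ∈ Icc τ T := by
        have hc : ContinuousAt (fun s : ℝ => t + s) 0 := by fun_prop
        exact hc.eventually (Icc_mem_nhds (by simpa using htτ) (by simpa using htT))
      filter_upwards [this] with s hs
      have := hmin' _ hs (f 0) hθ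
      have e : 2 * τ - (t + s) = 2 * τ - t + -s := by ring
      simpa [reflDiff, e] using this)
  have hang : ∀ i, i ≠ 0 → ∀ b b' : ℝ,
      HasSecondDerivAtZero (fun s => cyl v X t (Real.cos s • f 0 + Real.sin s • f i)) b →
      HasSecondDerivAtZero
        (fun s => cyl v X (2 * τ - t) (Real.cos s • f 0 + Real.sin s • f i)) b' → b' ≤ b := by
    intro i hi b b' hb hb'
    refine sub_nonneg.1 ((hb.sub hb').nonneg_of_isLocalMin ?_)
    filter_upwards with s
    have := hmin' t ht _ (hnorm i hi s)
    simp only [reflDiff] at this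
    simp
    linarith
  have hbb := hang 1 (by decide) _ _ hb hb'
  have hcc := hang 2 (by decide) _ _ hc hc'
  have hy := h.mem_ball ht.2 hθ
  have hy' := h.mem_ball (t := 2 * τ - t) (by linarith) hθ
  have e5 : ∀ r, Real.exp (5 * r / 2) * lap v (X + Real.exp r • f 0) =
      Real.exp (5 * r / 2) * (lap v (X + Real.exp r • f 0) + K (X + Real.exp r • f 0) *
        v (X + Real.exp r • f 0) ^ 5) - K (X + Real.exp r • f 0) * cyl v X r (f 0) ^ 5 := by
    intro r
    have : Real.exp (5 * r / 2) = Real.exp (r / 2) ^ 5 := by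
      rw [← Real.exp_nat_mul]; congr 1; push_cast; ring
    rw [cyl, this]; ring
  rw [e5, h.eq _ hy] at habc
  rw [e5, h.eq _ hy'] at habc'
  have hΦ' := h.cyl_pos (t := 2 * τ - t) (by linarith) hθ
  have hcmp : cyl v X (2 * τ - t) (f 0) ≤ cyl v X t (f 0) := by
    have h1 := h0 t ht _ hθ
    have := mul_nonneg hA0.le (corr_nonneg τ t)
    unfold reflDiff at h1
    linarith
  have hmono : K (X + Real.exp t • f 0) * cyl v X (2 * τ - t) (f 0) ^ 5 ≤
      K (X + Real.exp t • f 0) * cyl v X t (f 0) ^ 5 := by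
    have := h.K_nonneg _ hy
    gcongr
  have hKdiff : K (X + Real.exp (2 * τ - t) • f 0) - K (X + Real.exp t • f 0) ≤
      L * Real.exp t := by
    refine (h.lipschitz _ hy _ hy').trans ?_
    have h1 : Real.exp (2 * τ - t) ≤ Real.exp t := Real.exp_le_exp.2 (by linarith)
    have h2 : X + Real.exp (2 * τ - t) • f 0 - (X + Real.exp t • f 0) =
        (Real.exp (2 * τ - t) - Real.exp t) • f 0 := by module
    rw [h2, norm_smul, hθ, Real.norm_eq_abs, abs_of_nonpos (by linarith)]
    have := Real.exp_pos (2 * τ - t)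
    nlinarith
  have herr : (K (X + Real.exp (2 * τ - t) • f 0) - K (X + Real.exp t • f 0)) *
      cyl v X (2 * τ - t) (f 0) ^ 5 ≤ A * Real.exp (-3 / 2 * t + 5 * τ) := by
    have h1 := h.cyl_le ht' hθ
    have h2 : A * Real.exp (-3 / 2 * t + 5 * τ) =
        L * Real.exp t * (Real.exp ((2 * τ - t) / 2) * B) ^ 5 := by
      have : Real.exp (-3 / 2 * t + 5 * τ) = Real.exp t * Real.exp ((2 * τ - t) / 2) ^ 5 := by
        rw [← Real.exp_nat_mul, ← Real.exp_add]; congr 1; push_cast; ring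
      rw [this, hA]; ring
    rw [h2]
    have := Real.exp_pos t
    gcongr
  have hE : 0 < A * Real.exp (-3 / 2 * t + 5 * τ) := by positivity
  unfold reflDiff at hneg
  linarith

end MovingSphereSetup

lemma HasDerivAt.nonneg_of_nonneg_right {g : ℝ → ℝ} {g' τ T : ℝ} (hT : τ < T)
    (hg : HasDerivAt g g' τ) (h0 : g τ = 0) (h : ∀ t ∈ Icc τ T, 0 ≤ g t) : 0 ≤ g' := by
  have h1 := hg.hasDerivWithinAt (s := Ioi τ)
  rw [hasDerivWithinAt_iff_tendsto_slope' self_notMem_Ioi] at h1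
  refine ge_of_tendsto h1 ?_
  filter_upwards [Ioo_mem_nhdsGT hT] with t ht
  rw [slope_def_field, h0]
  exact div_nonneg (by linarith [h t ⟨ht.1.le, ht.2.le⟩]) (by linarith [ht.1])

/-- The derivative of `reflDiff` in the logarithmic radial variable. -/
def reflDiffDeriv (v : E3 → ℝ) (X : E3) (A τ t : ℝ) (θ : E3) : ℝ :=
  cylDeriv v X t θ + cylDeriv v X (2 * τ - t) θ - A * corrDeriv τ t

namespace MovingSphereSetup

variable {v K : E3 → ℝ} {X : E3} {ρ L B m τ₀ T : ℝ}

lemma hasDerivAt_reflDiff (h : MovingSphereSetup v K X ρ L B m τ₀ T) (A : ℝ) {τ t : ℝ}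
    (hτ : 2 * τ - t ≤ T) (ht : t ≤ T) {θ : E3} (hθ : ‖θ‖ = 1) :
    HasDerivAt (fun t => reflDiff v X A τ t θ) (reflDiffDeriv v X A τ t θ) t := by
  have h1 := hasDerivAt_cyl ((h.contDiffAt ht hθ).differentiableAt (by norm_num))
  have h2 := hasDerivAt_cyl ((h.contDiffAt hτ hθ).differentiableAt (by norm_num))
  refine ((h1.sub (h2.comp_const_sub (2 * τ) t)).sub ((hasDerivAt_corr τ t).const_mul A)).congr_deriv ?_
  rw [reflDiffDeriv]; ring

lemma continuousAt_reflDiffDeriv (h : MovingSphereSetup v K X ρ L B m τ₀ T) (A : ℝ)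
    {q : ℝ × ℝ × E3} (hτ : 2 * q.1 - q.2.1 ≤ T) (ht : q.2.1 ≤ T) (hθ : ‖q.2.2‖ = 1) :
    ContinuousAt (fun q : ℝ × ℝ × E3 => reflDiffDeriv v X A q.1 q.2.1 q.2.2) q := by
  have h1 : ContinuousAt (fun q : ℝ × ℝ × E3 => cylDeriv v X q.2.1 q.2.2) q :=
    ContinuousAt.comp (g := fun p : ℝ × E3 => cylDeriv v X p.1 p.2)
      (f := fun q : ℝ × ℝ × E3 => q.2)
      (continuousAt_cylDeriv (h.contDiffAt ht hθ)) (by fun_prop)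
  have h2 : ContinuousAt (fun q : ℝ × ℝ × E3 => cylDeriv v X (2 * q.1 - q.2.1) q.2.2) q :=
    ContinuousAt.comp (g := fun p : ℝ × E3 => cylDeriv v X p.1 p.2)
      (f := fun q : ℝ × ℝ × E3 => (2 * q.1 - q.2.1, q.2.2))
      (continuousAt_cylDeriv (h.contDiffAt hτ hθ)) (by fun_prop)
  have h3 : Continuous (fun q : ℝ × ℝ × E3 => corrDeriv q.1 q.2.1) := by
    unfold corrDeriv; fun_prop
  exact (h1.add h2).sub (h3.continuousAt.const_mul A)

/-- The radii (on a logarithmic scale) of the spheres for which the comparison of `v` with its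
Kelvin transform holds. -/
def goodRadii (v : E3 → ℝ) (X : E3) (A T : ℝ) : Set ℝ :=
  {τ | ∀ t ∈ Icc τ T, ∀ θ, ‖θ‖ = 1 → 0 ≤ reflDiff v X A τ t θ}

lemma isClosed_goodRadii (h : MovingSphereSetup v K X ρ L B m τ₀ T) (A τ₁ : ℝ) :
    IsClosed (goodRadii v X A T ∩ Icc τ₁ τ₀) := by
  have heq : goodRadii v X A T ∩ Icc τ₁ τ₀ = ⋂ (s ∈ Icc (0 : ℝ) 1) (θ ∈ sphere (0 : E3) 1),
      Icc τ₁ τ₀ ∩ (fun τ => reflDiff v X A τ (τ + s * (T - τ)) θ) ⁻¹' Ici 0 := by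
    ext τ
    simp only [mem_inter_iff, mem_iInter, mem_preimage, mem_Ici, mem_sphere_zero_iff_norm]
    constructor
    · rintro ⟨hS, hτ⟩ s hs θ hθ
      have : 0 < T - τ := by linarith [hτ.2, h.lt]
      exact ⟨hτ, hS _ ⟨by nlinarith [hs.1], by nlinarith [hs.2]⟩ θ hθ⟩
    · intro H
      have hτ := (H 0 (by simp) (EuclideanSpace.single 0 1) (by simp)).1
      have hpos : 0 < T - τ := by linarith [hτ.2, h.lt]
      refine ⟨fun t ht θ hθ => ?_, hτ⟩
      have := (H ((t - τ) / (T - τ)) ⟨div_nonneg (by linarith [ht.1]) hpos.le,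
        (div_le_one hpos).2 (by linarith [ht.2])⟩ θ hθ).2
      rwa [div_mul_cancel₀ _ hpos.ne', add_sub_cancel] at this
  rw [heq]
  refine isClosed_biInter fun s hs => isClosed_biInter fun θ hθ => ?_
  refine ContinuousOn.preimage_isClosed_of_isClosed ?_ isClosed_Icc isClosed_Ici
  intro τ hτ
  have : 0 < T - τ := by linarith [hτ.2, h.lt]
  exact (ContinuousAt.comp (g := fun q : ℝ × ℝ × E3 => reflDiff v X A q.1 q.2.1 q.2.2)
    (f := fun τ : ℝ => (τ, τ + s * (T - τ), θ))
    (h.continuousAt_reflDiff A (by dsimp only; nlinarith [hs.1]) (by dsimp only; nlinarith [hs.2])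
      (by simpa using hθ)) (by fun_prop)).continuousWithinAt

lemma exists_goodRadii_gt (h : MovingSphereSetup v K X ρ L B m τ₀ T) {τ : ℝ} (hτ : τ ≤ τ₀)
    (hS : τ ∈ goodRadii v X (L * B ^ 5) T) :
    ∀ᶠ τ' in nhds τ, τ < τ' → τ' ∈ goodRadii v X (L * B ^ 5) T := by
  set A := L * B ^ 5 with hA
  have hlt := h.lt
  have hτT : τ < T := by linarith
  have hbT := barrier_pos hτT
  set g := Real.exp (T / 2) * (m - (B * Real.exp (τ₀ - T) + L * B ^ 5 * Real.exp (3 * τ₀)))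
  have hg : 0 < g := mul_pos (Real.exp_pos _) (by linarith [h.gap])
  have hlow := h.barrier_le_reflDiff (δ := g / barrier τ T) hτ (fun θ hθ => by
    rw [div_mul_cancel₀ _ hbT.ne']; exact h.reflDiff_outer hτ hθ) hS
  have hδ : 0 < g / barrier τ T := by positivity
  set δ := g / barrier τ T
  have hcomp : IsCompact (Icc τ T ×ˢ sphere (0 : E3) 1) := isCompact_Icc.prod (isCompact_sphere _ _)
  have key := hcomp.eventually_forall_of_forall_eventually (x₀ := τ)
    (P := fun τ' p => ‖p.2‖ = 1 → p.1 ≤ T → τ' ≤ p.1 → 0 ≤ reflDiff v X A τ' p.1 p.2) (by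
      rintro ⟨t, θ⟩ ⟨ht, hθ⟩
      have hθ' : ‖θ‖ = 1 := by simpa using hθ
      dsimp only at ht
      rcases ht.1.eq_or_lt with rfl | htτ
      · have hd := h.hasDerivAt_reflDiff A (τ := τ) (t := τ) (by linarith) hτT.le hθ'
        have hd' := (hd.sub ((hasDerivAt_barrier_self τ).const_mul δ)).nonneg_of_nonneg_right hτT
          (by simp [reflDiff_self, barrier_self])
          (fun s hs => sub_nonneg.2 (hlow s hs θ hθ'))
        have hpos : 0 < reflDiffDeriv v X A τ τ θ := by
          have : 0 < δ * Real.exp (-(1 / 2) * τ) := by positivity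
          linarith
        have hev := (h.continuousAt_reflDiffDeriv A (q := (τ, τ, θ)) (by dsimp only; linarith)
          hτT.le hθ').eventually (lt_mem_nhds hpos)
        have hevT : ∀ᶠ q : ℝ × ℝ × E3 in nhds (τ, τ, θ), 2 * q.1 - q.2.1 < T := by
          have hc : ContinuousAt (fun q : ℝ × ℝ × E3 => 2 * q.1 - q.2.1) (τ, τ, θ) := by fun_prop
          exact hc.eventually (gt_mem_nhds (by dsimp only; linarith))
        obtain ⟨ε, hε, hball⟩ := Metric.eventually_nhds_iff.1 (hev.and hevT)
        refine Metric.eventually_nhds_iff.2 ⟨ε, hε, ?_⟩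
        rintro ⟨τ', t, η⟩ hd hη htT hτt
        dsimp only at hη htT hτt ⊢
        simp only [Prod.dist_eq, max_lt_iff, Real.dist_eq, abs_lt] at hd
        have hseg : ∀ s ∈ Icc τ' t, 0 < reflDiffDeriv v X A τ' s η ∧ 2 * τ' - s < T := by
          intro s hs
          refine hball (y := (τ', s, η)) ?_
          simp only [Prod.dist_eq, max_lt_iff, Real.dist_eq, abs_lt]
          refine ⟨hd.1, ⟨?_, ?_⟩, hd.2.2⟩ <;> linarith [hs.1, hs.2, hd.1.1, hd.2.1.2]
        have hder : ∀ s ∈ Icc τ' t, HasDerivAt (fun t => reflDiff v X A τ' t η)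
            (reflDiffDeriv v X A τ' s η) s := fun s hs =>
          h.hasDerivAt_reflDiff A (hseg s hs).2.le (hs.2.trans htT) hη
        have hmono : MonotoneOn (fun t => reflDiff v X A τ' t η) (Icc τ' t) :=
          monotoneOn_of_hasDerivWithinAt_nonneg (convex_Icc _ _)
            (fun s hs => (hder s hs).continuousAt.continuousWithinAt)
            (fun s hs => (hder s (interior_subset hs)).hasDerivWithinAt)
            (fun s hs => (hseg s (interior_subset hs)).1.le)
        have := hmono ⟨le_rfl, hτt⟩ ⟨hτt, le_rfl⟩ hτt
        simpa only [reflDiff_self] using this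
      · have hpos : 0 < reflDiff v X A τ t θ :=
          (mul_pos hδ (barrier_pos htτ)).trans_le (hlow t ht θ hθ')
        have hev := (h.continuousAt_reflDiff A (q := (τ, t, θ)) htτ.le ht.2 hθ').eventually
          (lt_mem_nhds hpos)
        filter_upwards [hev] with q hq _ _ _ using hq.le)
  filter_upwards [key] with τ' hτ' hlt' t ht θ hθ
  exact hτ' (t, θ) ⟨⟨hlt'.le.trans ht.1, ht.2⟩, by simpa using hθ⟩ hθ ht.2 ht.1

lemma exists_mem_goodRadii (h : MovingSphereSetup v K X ρ L B m τ₀ T) :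
    ∃ τ ≤ τ₀, τ ∈ goodRadii v X (L * B ^ 5) T := by
  set A := L * B ^ 5 with hA
  have hL := h.L_pos
  have hB := h.B_pos
  have hlt := h.lt
  have hA0 : 0 < A := by positivity
  have hsub : closedBall X (Real.exp T) ⊆ ball X ρ := closedBall_subset_ball h.exp_lt
  have hmem : ∀ {t : ℝ}, t ≤ T → ∀ {θ : E3}, ‖θ‖ = 1 →
      X + Real.exp t • θ ∈ closedBall X (Real.exp T) := by
    intro t ht θ hθ
    simpa [norm_smul, hθ] using ht
  have hcomp := isCompact_closedBall X (Real.exp T)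
  obtain ⟨μ, hμ, hμv⟩ := hcomp.exists_forall_le' (h.contDiffOn.continuousOn.mono hsub)
    (a := 0) (fun x hx => h.pos x (hsub hx))
  obtain ⟨D, hD⟩ := hcomp.exists_bound_of_continuousOn
    ((h.contDiffOn.continuousOn_fderiv_of_isOpen isOpen_ball (by norm_num)).mono hsub)
  have hD0 : 0 ≤ D := (norm_nonneg _).trans (hD X (mem_closedBall_self (Real.exp_pos _).le))
  have hexp : Filter.Tendsto Real.exp Filter.atBot (nhds 0) := Real.tendsto_exp_atBot
  have hsmall : ∀ᶠ t in Filter.atBot, Real.exp t * D < μ / 4 := by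
    have := hexp.mul_const D
    rw [zero_mul] at this
    exact this.eventually (gt_mem_nhds (by positivity))
  obtain ⟨t₀, ht₀D, ht₀T⟩ := (hsmall.and (Filter.eventually_le_atBot T)).exists
  have hev1 : ∀ᶠ τ in Filter.atBot, B * Real.exp (τ - t₀) < μ / 2 := by
    have := (hexp.comp (Filter.tendsto_atBot_add_const_right _ (-t₀) Filter.tendsto_id)).const_mul B
    rw [mul_zero] at this
    exact this.eventually (gt_mem_nhds (by positivity))
  have hev2 : ∀ᶠ τ in Filter.atBot, A * Real.exp (3 * τ) < μ / 2 := by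
    have := (hexp.comp (Filter.Tendsto.const_mul_atBot (by norm_num : (0 : ℝ) < 3)
      Filter.tendsto_id)).const_mul A
    rw [mul_zero] at this
    exact this.eventually (gt_mem_nhds (by positivity))
  obtain ⟨τ, ⟨hτ1, hτ2⟩, hτ0⟩ := ((hev1.and hev2).and (Filter.eventually_le_atBot τ₀)).exists
  refine ⟨τ, hτ0, fun t ht θ hθ => ?_⟩
  have hcorr : A * corr τ t ≤ Real.exp (t / 2) * (μ / 2) * (1 - Real.exp (τ - t)) := by
    have h1 : Real.exp (τ - t) ≤ 1 := Real.exp_le_one_iff.2 (by linarith [ht.1])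
    calc A * corr τ t ≤ A * (Real.exp (t / 2) * (Real.exp (3 * τ) * (1 - Real.exp (τ - t)))) := by
          gcongr; exact corr_le ht.1
      _ = Real.exp (t / 2) * (A * Real.exp (3 * τ)) * (1 - Real.exp (τ - t)) := by ring
      _ ≤ _ := by gcongr
  have hsplit : Real.exp ((2 * τ - t) / 2) = Real.exp (t / 2) * Real.exp (τ - t) := by
    rw [← Real.exp_add]; congr 1; ring
  rcases le_total t t₀ with htt | htt
  · have hder : ∀ s ≤ t₀, HasDerivAt (fun s => cyl v X s θ - μ / 2 * Real.exp (1 / 2 * s + 0))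
        (cylDeriv v X s θ - μ / 2 * (1 / 2 * Real.exp (1 / 2 * s + 0))) s := fun s hs =>
      (hasDerivAt_cyl ((h.contDiffAt (hs.trans ht₀T) hθ).differentiableAt (by norm_num))).sub
        ((hasDerivAt_exp_mul_add _ _ s).const_mul _)
    have hmono : MonotoneOn (fun s => cyl v X s θ - μ / 2 * Real.exp (1 / 2 * s + 0)) (Iic t₀) := by
      refine monotoneOn_of_hasDerivWithinAt_nonneg (convex_Iic _)
            (fun s hs => (hder s hs).continuousAt.continuousWithinAt)
            (fun s hs => (hder s (interior_subset (s := Iic t₀) hs)).hasDerivWithinAt) fun s hs => ?_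
      have hs' : s ≤ t₀ := interior_subset (s := Iic t₀) hs
      have hm := hmem (hs'.trans ht₀T) hθ
      have h1 := hμv _ hm
      have h2 : |fderiv ℝ v (X + Real.exp s • θ) (Real.exp s • θ)| ≤ D * Real.exp s := by
        have := (fderiv ℝ v (X + Real.exp s • θ)).le_of_opNorm_le (hD _ hm) (Real.exp s • θ)
        simpa [norm_smul, hθ] using this
      have h3 : D * Real.exp s ≤ μ / 4 := by
        have : Real.exp s ≤ Real.exp t₀ := Real.exp_le_exp.2 hs'
        nlinarith
      have h4 : 1 / 2 * s + 0 = s / 2 := by ring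
      rw [h4, cylDeriv]
      have h5 := Real.exp_pos (s / 2)
      have h6 := neg_le_of_abs_le h2
      nlinarith
    have := hmono (a := 2 * τ - t) (b := t) (by simp; linarith [ht.1]) htt (by linarith [ht.1])
    dsimp only at this
    have e1 : 1 / 2 * t + 0 = t / 2 := by ring
    have e2 : 1 / 2 * (2 * τ - t) + 0 = (2 * τ - t) / 2 := by ring
    rw [e1, e2, hsplit] at this
    unfold reflDiff
    linarith
  · have h1 : Real.exp (t / 2) * μ ≤ cyl v X t θ := by
      unfold cyl; gcongr; exact hμv _ (hmem ht.2 hθ)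
    have h2 := h.cyl_le (t := 2 * τ - t) (by linarith [ht.1]) hθ
    rw [hsplit] at h2
    have h3 : Real.exp (τ - t) ≤ Real.exp (τ - t₀) := Real.exp_le_exp.2 (by linarith)
    have h4 : B * Real.exp (τ - t) ≤ μ / 2 := by nlinarith
    have h5 := Real.exp_pos (t / 2)
    have h6 : Real.exp (t / 2) * (B * Real.exp (τ - t)) ≤ Real.exp (t / 2) * (μ / 2) := by gcongr
    have h7 : 0 ≤ Real.exp (t / 2) * (μ / 2) * Real.exp (τ - t) := by positivity
    unfold reflDiff
    linarith

lemma mem_goodRadii (h : MovingSphereSetup v K X ρ L B m τ₀ T) :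
    τ₀ ∈ goodRadii v X (L * B ^ 5) T := by
  obtain ⟨τ₁, hτ₁, hS⟩ := h.exists_mem_goodRadii
  refine (h.isClosed_goodRadii (L * B ^ 5) τ₁).Icc_subset_of_forall_exists_gt hS ?_ ⟨hτ₁, le_rfl⟩
  rintro τ ⟨hτ, hτ'⟩ y hy
  have hev := (h.exists_goodRadii_gt hτ'.2.le hτ).filter_mono (nhdsWithin_le_nhds (s := Ioi τ))
  obtain ⟨τ', h1, h2⟩ := (hev.and (Ioc_mem_nhdsGT hy)).exists
  exact ⟨τ', h1 h2.1, h2⟩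

/-- Comparison of `v` with its Kelvin transform in the largest sphere. -/
lemma kelvin_le (h : MovingSphereSetup v K X ρ L B m τ₀ T) {t : ℝ} (ht : t ∈ Icc τ₀ T) {θ : E3}
    (hθ : ‖θ‖ = 1) :
    Real.exp (τ₀ - t) * v (X + Real.exp (2 * τ₀ - t) • θ) ≤ v (X + Real.exp t • θ) := by
  have h1 := h.mem_goodRadii t ht θ hθ
  have hL := h.L_pos
  have hB := h.B_pos
  have hsplit : Real.exp ((2 * τ₀ - t) / 2) = Real.exp (t / 2) * Real.exp (τ₀ - t) := by
    rw [← Real.exp_add]; congr 1; ring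
  have h2 : 0 ≤ L * B ^ 5 * corr τ₀ t := mul_nonneg (by positivity) (corr_nonneg _ _)
  rw [reflDiff, cyl, cyl, hsplit] at h1
  refine le_of_mul_le_mul_left ?_ (Real.exp_pos (t / 2))
  linarith

end MovingSphereSetup

lemma lap_add_nonneg_of_isLocalMin {u : E3 → ℝ} {x₀ x : E3} {k : ℝ} (hu : ContDiffAt ℝ 2 u x)
    (hmin : IsLocalMin (fun y => u y + k * ‖y - x₀‖ ^ 2) x) : 0 ≤ lap u x + 6 * k := by
  have key : ∀ i : Fin 3, 0 ≤ fderiv ℝ (fderiv ℝ u) x (EuclideanSpace.basisFun (Fin 3) ℝ i)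
      (EuclideanSpace.basisFun (Fin 3) ℝ i) + 2 * k := by
    intro i
    set e := EuclideanSpace.basisFun (Fin 3) ℝ i
    have he : ‖e‖ = 1 := (EuclideanSpace.basisFun (Fin 3) ℝ).orthonormal.1 i
    have h1 : ∀ s, HasDerivAt (fun s : ℝ => x + s • e) e s := fun s => by
      simpa using ((hasDerivAt_id s).smul_const e).const_add x
    have h2 := hasSecondDerivAtZero_comp_curve (v := u) (γ := fun s : ℝ => x + s • e)
      (by simpa using hu) h1 (hasDerivAt_const 0 e)
    have h3 : HasSecondDerivAtZero (fun s : ℝ => k * ‖x + s • e - x₀‖ ^ 2) (k * 2) := by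
      refine HasSecondDerivAtZero.const_mul k ?_
      have e1 : (fun s : ℝ => ‖x + s • e - x₀‖ ^ 2) =
          fun s => ‖x - x₀‖ ^ 2 + 2 * inner ℝ (x - x₀) e * s + s ^ 2 := by
        funext s
        have : x + s • e - x₀ = (x - x₀) + s • e := by module
        rw [this, norm_add_sq_real, inner_smul_right, norm_smul, he]
        simp
        ring
      rw [e1]
      refine ⟨fun s => 2 * inner ℝ (x - x₀) e + 2 * s, Filter.Eventually.of_forall fun s => ?_, ?_⟩
      · refine ((((hasDerivAt_id s).const_mul _).const_add _).add (hasDerivAt_pow 2 s)).congr_deriv ?_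
        simp
      · simpa using ((hasDerivAt_id (0 : ℝ)).const_mul 2).const_add (2 * inner ℝ (x - x₀) e)
    have h4 := (h2.add h3).nonneg_of_isLocalMin (by
      have hc : ContinuousAt (fun s : ℝ => x + s • e) 0 := (h1 0).continuousAt
      have ht : Filter.Tendsto (fun s : ℝ => x + s • e) (nhds 0) (nhds x) := by
        simpa using hc.tendsto
      filter_upwards [ht.eventually hmin] with s hs
      simpa using hs)
    simp only [zero_smul, add_zero, map_zero] at h4
    linarith
  rw [lap_eq_sum_orthonormalBasis hu (EuclideanSpace.basisFun (Fin 3) ℝ), Fin.sum_univ_three]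
  linarith [key 0, key 1, key 2]

/-- A positive solution is nearly constant at the natural scale around a high peak. -/
lemma le_near_peak {u K : E3 → ℝ} {x₀ : E3} {R Λ M m T : ℝ} (hR : 0 < R) (hΛ : 0 < Λ)
    (hM : 0 < M) (hT : 0 < T) (hu : ContDiffOn ℝ 2 u (ball x₀ (R / 2)))
    (hpos : ∀ x ∈ ball x₀ (R / 2), 0 < u x) (hK : ∀ x ∈ ball x₀ (R / 2), 0 ≤ K x)
    (hlip : ∀ x ∈ ball x₀ (R / 2), ∀ y ∈ ball x₀ (R / 2), K y - K x ≤ Λ / R * ‖y - x‖)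
    (heq : ∀ x ∈ ball x₀ (R / 2), lap u x + K x * u x ^ 5 = 0)
    (hM_eq : u x₀ = M) (hub : ∀ x ∈ closedBall x₀ ((2 * T + 1) / M ^ 2), u x ≤ 2 * M)
    (hm : ∀ x ∈ ball x₀ (R / 2), m ≤ u x) (hRM : 8 * (T + 1) < R * M ^ 2)
    (hgap : 8 * (T + 1) + 32 * Λ * (T + 1) ^ 3 < m * M * R) :
    ∀ x ∈ closedBall x₀ (1 / M ^ 2), T / (T + 1) * M ≤ u x := by
  intro x hx
  have hM2 : 0 < M ^ 2 := by positivity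
  rcases eq_or_ne x x₀ with rfl | hne
  · rw [hM_eq]
    have : T / (T + 1) ≤ 1 := (div_le_one (by linarith)).2 (by linarith)
    nlinarith
  have hμ8 : (T + 1) * (1 / M ^ 2) < R / 8 := by
    rw [mul_one_div, div_lt_iff₀ hM2]; linarith
  have hμ0 : 0 < 1 / M ^ 2 := by positivity
  set μ := 1 / M ^ 2 with hμ
  set r := ‖x - x₀‖ with hr
  have hr0 : 0 < r := norm_pos_iff.2 (sub_ne_zero.2 hne)
  have hrμ : r ≤ μ := by rwa [mem_closedBall, dist_eq_norm] at hx
  set θ := r⁻¹ • (x - x₀) with hθ_def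
  have hθ : ‖θ‖ = 1 := by
    rw [hθ_def, norm_smul, norm_inv, Real.norm_of_nonneg hr0.le, ← hr, inv_mul_cancel₀ hr0.ne']
  have hrθ : r • θ = x - x₀ := by rw [hθ_def, smul_inv_smul₀ hr0.ne']
  set X := x₀ - (T * μ) • θ with hX
  have hTμ : 0 < T * μ := by positivity
  have hXd : dist X x₀ = T * μ := by
    rw [dist_eq_norm, hX, sub_sub_cancel_left, norm_neg, norm_smul, hθ, mul_one,
      Real.norm_of_nonneg hTμ.le]
  have hsub : ball X (3 * R / 8) ⊆ ball x₀ (R / 2) := ball_subset_ball' (by linarith)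
  set t := Real.log (T * μ + r) with ht
  set τ₀ := (Real.log (T * μ) + t) / 2 with hτ₀
  have hlog : Real.log (T * μ) ≤ t := Real.log_le_log hTμ (by linarith)
  have hexp_t : Real.exp t = T * μ + r := Real.exp_log (by linarith)
  have hexp_R : Real.exp (Real.log (R / 4)) = R / 4 := Real.exp_log (by linarith)
  have hexpτ : Real.exp τ₀ ≤ (T + 1) * μ := by
    have : Real.exp τ₀ ≤ Real.exp t := Real.exp_le_exp.2 (by linarith)
    linarith
  have htR : t ≤ Real.log (R / 4) := Real.log_le_log (by linarith) (by linarith)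
  have hsetup : MovingSphereSetup u K X (3 * R / 8) (Λ / R) (2 * M) m τ₀ (Real.log (R / 4)) :=
    { exp_lt := by rw [hexp_R]; linarith
      lt := by
        rw [← Real.exp_lt_exp, hexp_R]; linarith
      contDiffOn := hu.mono hsub
      pos := fun x hx => hpos x (hsub hx)
      K_nonneg := fun x hx => hK x (hsub hx)
      lipschitz := fun x hx y hy => hlip x (hsub hx) y (hsub hy)
      eq := fun x hx => heq x (hsub hx)
      L_pos := by positivity
      B_pos := by positivity
      le_B := fun x hx => hub x (closedBall_subset_closedBall' (by
        rw [hXd]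
        have : (2 * T + 1) / M ^ 2 = (2 * T + 1) * μ := by rw [hμ, mul_one_div]
        rw [this]
        linarith) hx)
      m_le := fun x hx => hm x (hsub (by
        rw [mem_sphere, hexp_R] at hx
        rw [mem_ball, hx]
        linarith))
      gap := by
        have h3 : Real.exp (3 * τ₀) ≤ ((T + 1) * μ) ^ 3 := by
          have : Real.exp (3 * τ₀) = Real.exp τ₀ ^ 3 := by
            rw [← Real.exp_nat_mul]; norm_num
          rw [this]
          gcongr
        rw [Real.exp_sub, hexp_R]
        calc 2 * M * (Real.exp τ₀ / (R / 4)) + Λ / R * (2 * M) ^ 5 * Real.exp (3 * τ₀)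
            ≤ 2 * M * ((T + 1) * μ / (R / 4)) + Λ / R * (2 * M) ^ 5 * ((T + 1) * μ) ^ 3 := by
              gcongr
          _ = (8 * (T + 1) + 32 * Λ * (T + 1) ^ 3) / (M * R) := by
              rw [hμ]; field_simp; ring
          _ < m := by
              rw [div_lt_iff₀ (by positivity)]
              linarith }
  have h := hsetup.kelvin_le (t := t) ⟨by linarith, htR⟩ hθ
  have e1 : 2 * τ₀ - t = Real.log (T * μ) := by rw [hτ₀]; ring
  have e2 : X + (T * μ) • θ = x₀ := by rw [hX]; module
  have e3 : X + (T * μ + r) • θ = x := by rw [hX, add_smul, hrθ]; module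
  rw [e1, Real.exp_log hTμ, hexp_t, e2, e3, hM_eq] at h
  refine le_trans ?_ h
  have e4 : Real.exp (Real.log (T * μ) - t) ≤ Real.exp (τ₀ - t) :=
    Real.exp_le_exp.2 (by linarith)
  rw [Real.exp_sub, Real.exp_log hTμ, hexp_t] at e4
  have e5 : T / (T + 1) ≤ T * μ / (T * μ + r) := by
    rw [div_le_div_iff₀ (by linarith) (by linarith)]
    nlinarith
  gcongr
  exact e5.trans e4

/-- A positive solution cannot be nearly constant at the natural scale around a peak. -/
lemma not_nearly_constant {u K : E3 → ℝ} {x₀ : E3} {r Λ M q : ℝ} (hΛ : 0 < Λ) (hM : 0 < M)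
    (hr : 1 / M ^ 2 < r) (hu : ContDiffOn ℝ 2 u (ball x₀ r))
    (hK : ∀ x ∈ ball x₀ r, Λ⁻¹ ≤ K x) (heq : ∀ x ∈ ball x₀ r, lap u x + K x * u x ^ 5 = 0)
    (hM_eq : u x₀ = M) (hq : 1 / 2 ≤ q) (hq' : 1 - Λ⁻¹ / 200 < q)
    (hlow : ∀ x ∈ closedBall x₀ (1 / M ^ 2), q * M ≤ u x) : False := by
  have hsub : closedBall x₀ (1 / M ^ 2) ⊆ ball x₀ r := closedBall_subset_ball hr
  set k := Λ⁻¹ / 200 * M ^ 5 with hk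
  have hcont : ContinuousOn (fun y => u y + k * ‖y - x₀‖ ^ 2) (closedBall x₀ (1 / M ^ 2)) :=
    (hu.continuousOn.mono hsub).add (by fun_prop)
  have hx₀ : x₀ ∈ closedBall x₀ (1 / M ^ 2) := mem_closedBall_self (by positivity)
  obtain ⟨x, hx, hmin⟩ := (isCompact_closedBall x₀ (1 / M ^ 2)).exists_isMinOn ⟨x₀, hx₀⟩ hcont
  have h0 : u x + k * ‖x - x₀‖ ^ 2 ≤ M := by
    have := hmin hx₀
    simpa [hM_eq] using this
  have hlx := hlow x hx
  rcases (mem_closedBall.1 hx).eq_or_lt with hd | hd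
  · rw [← dist_eq_norm, hd] at h0
    have : k * (1 / M ^ 2) ^ 2 = Λ⁻¹ / 200 * M := by rw [hk]; field_simp
    rw [this] at h0
    nlinarith
  · have hloc := hmin.isLocalMin (mem_interior_iff_mem_nhds.1
      (ball_subset_interior_closedBall (mem_ball.2 hd)))
    have h1 := lap_add_nonneg_of_isLocalMin
      (hu.contDiffAt (isOpen_ball.mem_nhds (hsub hx))) hloc
    have h2 := heq x (hsub hx)
    have h3 : Λ⁻¹ * (1 / 2 * M) ^ 5 ≤ K x * u x ^ 5 := by
      have := hK x (hsub hx)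
      have : 1 / 2 * M ≤ u x := by nlinarith
      gcongr
      exact (inv_pos.2 hΛ).le.trans ‹_›
    have h4 : 0 < Λ⁻¹ * M ^ 5 := by positivity
    rw [hk] at h1
    nlinarith

/-- Selection of a peak around which a function is controlled by its value at the peak. -/
lemma exists_peak {u : E3 → ℝ} {y : E3} {R : ℝ} (hR : 0 < R)
    (hu : ContinuousOn u (closedBall y (R / 2))) (hpos : ∀ x ∈ closedBall y (R / 2), 0 < u x) :
    ∃ x₀ d, 0 < d ∧ d + dist x₀ y = R / 2 ∧ u y ^ 2 * (R / 2) ≤ u x₀ ^ 2 * d ∧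
      ∀ x ∈ closedBall x₀ (d / 2), u x ≤ 2 * u x₀ := by
  have hy : y ∈ closedBall y (R / 2) := mem_closedBall_self (by linarith)
  obtain ⟨x₀, hx₀, hmax⟩ := (isCompact_closedBall y (R / 2)).exists_isMaxOn ⟨y, hy⟩
    (f := fun x => u x ^ 2 * (R / 2 - dist x y)) ((hu.pow 2).mul (by fun_prop))
  have h1 : u y ^ 2 * (R / 2) ≤ u x₀ ^ 2 * (R / 2 - dist x₀ y) := by
    simpa using hmax hy
  have hu0 := hpos _ hx₀
  have hd : 0 < R / 2 - dist x₀ y := by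
    have : 0 < u y ^ 2 * (R / 2) := by have := hpos _ hy; positivity
    exact pos_of_mul_pos_right (this.trans_le h1) (by positivity)
  refine ⟨x₀, R / 2 - dist x₀ y, hd, by ring, h1, fun x hx => ?_⟩
  rw [mem_closedBall] at hx
  have h2 := dist_triangle x x₀ y
  have hxm : x ∈ closedBall y (R / 2) := by rw [mem_closedBall]; linarith
  have h3 : u x ^ 2 * (R / 2 - dist x y) ≤ u x₀ ^ 2 * (R / 2 - dist x₀ y) := hmax hxm
  have h4 : u x ^ 2 * ((R / 2 - dist x₀ y) / 2) ≤ u x ^ 2 * (R / 2 - dist x y) := by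
    gcongr; linarith
  have h5 : u x ^ 2 ≤ 2 * u x₀ ^ 2 := by nlinarith
  nlinarith

/-- Interior Harnack-type inequality (flat-metric case of Proposition sep11p1). -/
theorem stmt15 (Λ : ℝ) (hΛ : 0 < Λ) :
    ∃ C : ℝ, 0 < C ∧
      ∀ (R : ℝ) (p : E3) (u K : E3 → ℝ), 0 < R →
        (∀ x ∈ ball p (3 * R), 0 < u x) →
        ContDiffOn ℝ 2 u (ball p (3 * R)) →
        ContDiffOn ℝ 1 K (ball p (3 * R)) →
        (∀ x ∈ ball p (3 * R), Λ⁻¹ ≤ K x ∧ K x ≤ Λ ∧ ‖fderiv ℝ K x‖ ≤ Λ / R) →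
        (∀ x ∈ ball p (3 * R), lap u x + K x * u x ^ 5 = 0) →
        sSup (u '' ball p R) * sInf (u '' ball p (2 * R)) ≤ C / R := by
  set T : ℝ := 1 + 200 * Λ with hT
  have hT0 : 0 < T := by positivity
  refine ⟨8 * (T + 1) + 32 * Λ * (T + 1) ^ 3, by positivity, ?_⟩
  intro R p u K hR hpos hu hKd hK heq
  by_contra! hcon
  set C := 8 * (T + 1) + 32 * Λ * (T + 1) ^ 3 with hC
  have hC8 : 8 * (T + 1) ≤ C := by
    have : 0 ≤ 32 * Λ * (T + 1) ^ 3 := by positivity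
    linarith
  have hC0 : 0 < C := by positivity
  have h23 : ball p (2 * R) ⊆ ball p (3 * R) := ball_subset_ball (by linarith)
  set m := sInf (u '' ball p (2 * R)) with hm
  have hm_le : ∀ x ∈ ball p (2 * R), m ≤ u x := fun x hx =>
    csInf_le ⟨0, by rintro _ ⟨y, hy, rfl⟩; exact (hpos y (h23 hy)).le⟩ ⟨x, hx, rfl⟩
  have hm0 : 0 ≤ m := Real.sInf_nonneg (by rintro _ ⟨y, hy, rfl⟩; exact (hpos y (h23 hy)).le)
  have hm0' : 0 < m := by
    refine hm0.lt_of_ne fun h => ?_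
    rw [← h, mul_zero] at hcon
    exact absurd hcon (not_lt.2 (by positivity))
  obtain ⟨_, ⟨y, hy, rfl⟩, hyC⟩ := exists_lt_of_lt_csSup
    ((nonempty_ball.2 hR).image u) ((div_lt_iff₀ hm0').2 hcon)
  rw [div_lt_iff₀ hm0', div_lt_iff₀ hR] at hyC
  rw [mem_ball] at hy
  have hysub : closedBall y (R / 2) ⊆ ball p (3 * R) :=
    fun x hx => by
      have := dist_triangle x y p
      rw [mem_closedBall] at hx
      rw [mem_ball]; linarith
  obtain ⟨x₀, d, hd, hdist, hpeak, hub⟩ := exists_peak hR (hu.continuousOn.mono hysub)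
    (fun x hx => hpos x (hysub hx))
  have hsub2 : ball x₀ (R / 2) ⊆ ball p (2 * R) := ball_subset_ball' (by
    have := dist_triangle x₀ y p
    linarith)
  have hsub : ball x₀ (R / 2) ⊆ ball p (3 * R) := hsub2.trans h23
  have hM : 0 < u x₀ := hpos _ (hsub (mem_ball_self (by linarith)))
  have hy0 : 0 < u y := hpos _ (hysub (mem_closedBall_self (by linarith)))
  have hym : m ≤ u y := hm_le y (by rw [mem_ball]; linarith)
  set M := u x₀ with hM_def
  have hdR : d ≤ R / 2 := by linarith [dist_nonneg (x := x₀) (y := y)]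
  have hyM : u y ≤ M := by
    have : M ^ 2 * d ≤ M ^ 2 * (R / 2) := by gcongr
    have : u y ^ 2 ≤ M ^ 2 := le_of_mul_le_mul_right (hpeak.trans this) (by linarith)
    exact (pow_le_pow_iff_left₀ hy0.le hM.le (by norm_num)).1 this
  have hCd : C < 2 * (M ^ 2 * d) := by
    have : u y * m * R ≤ u y ^ 2 * R := by rw [sq]; gcongr
    linarith
  have hCR : C < R * M ^ 2 := by
    have : M ^ 2 * d ≤ M ^ 2 * (R / 2) := by gcongr
    linarith
  have hM2 : 0 < M ^ 2 := by positivity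
  have hlip : ∀ x ∈ ball x₀ (R / 2), ∀ z ∈ ball x₀ (R / 2), K z - K x ≤ Λ / R * ‖z - x‖ :=
    fun x hx z hz => (le_abs_self _).trans
      ((convex_ball x₀ (R / 2)).norm_image_sub_le_of_norm_fderiv_le
        (fun w hw => (hKd.contDiffAt (isOpen_ball.mem_nhds (hsub hw))).differentiableAt
          (by norm_num)) (fun w hw => (hK w (hsub hw)).2.2) hx hz)
  have hlow := le_near_peak (T := T) hR hΛ hM hT0 (hu.mono hsub) (fun x hx => hpos x (hsub hx))
    (fun x hx => (inv_pos.2 hΛ).le.trans (hK x (hsub hx)).1) hlip (fun x hx => heq x (hsub hx)) rfl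
    (fun x hx => hub x (closedBall_subset_closedBall (by
      rw [div_le_iff₀ hM2]; linarith) hx))
    (fun x hx => hm_le x (hsub2 hx)) (by linarith) (by
      refine hyC.trans_le ?_
      have : u y * m * R ≤ M * m * R := by gcongr
      linarith)
  refine not_nearly_constant (r := R / 2) (q := T / (T + 1)) hΛ hM ?_ (hu.mono hsub)
    (fun x hx => (hK x (hsub hx)).1) (fun x hx => heq x (hsub hx)) rfl ?_ ?_ hlow
  · rw [div_lt_iff₀ hM2]; linarith
  · rw [div_le_div_iff₀ (by norm_num) (by linarith)]; linarith
  · rw [lt_div_iff₀ (by linarith), hT]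
    have : 0 < Λ⁻¹ := inv_pos.2 hΛ
    have h1 : Λ⁻¹ * Λ = 1 := inv_mul_cancel₀ hΛ.ne'
    nlinarith
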